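/- arXiv:2501.05672 — 5 statements merged into one kernel-verified Lean document; each statement's English description precedes it below -/
import Mathlib

section
/- Suppose Assumption A holds, η > 0, and the Arrow–Pratt coefficient −u″/u′ is a nonincreasing function (DARA). Let w₁ ≤ w₂ be two initial wealth levels and let (a₁*, d₁*) and (a₂*, d₂*) denote the corresponding optimal premium–deductible pairs (same X, S, η, u). Then a₁* ≥ a₂*, d₁* ≤ d₂*, and a₁* + d₁* ≤ a₂* + d₂*. -/
open MeasureTheory Set

noncomputable section

variable {Ω : Type*} [MeasurableSpace Ω]
/-- Full-insurance premium `π_f = (1+η)𝔼[X]`. -/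
def piFull (ℙ : Measure Ω) (η : ℝ) (X : Ω → ℝ) : ℝ := (1 + η) * ∫ ω, X ω ∂ℙ

/-- `g(a) = (1+η)·𝔼[X − (X − (S+a)⁺)⁺] − a`. -/
def gfun (ℙ : Measure Ω) (η : ℝ) (X S : Ω → ℝ) (a : ℝ) : ℝ :=
  (1 + η) * ∫ ω, (X ω - max (X ω - max (S ω + a) 0) 0) ∂ℙ - a

/-- `ā = inf {a ∈ [0, π_f] : g(a) ≤ 0}`. -/
def abar (ℙ : Measure Ω) (η : ℝ) (X S : Ω → ℝ) : ℝ :=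
  sInf {a | a ∈ Icc 0 (piFull ℙ η X) ∧ gfun ℙ η X S a ≤ 0}

/-- Distribution function of a random variable. -/
def distFn (ℙ : Measure Ω) (Y : Ω → ℝ) (t : ℝ) : ℝ := (ℙ {ω | Y ω ≤ t}).toReal

/-- The set of discontinuity points in `[0, M]` of the distribution function of `Y`. -/
def JumpSet (ℙ : Measure Ω) (Y : Ω → ℝ) (M : ℝ) : Set ℝ :=
  {x ∈ Icc (0 : ℝ) M | ¬ ContinuousAt (distFn ℙ Y) x}

/-- Assumption A: (1) `S ≥ 0` a.s.; (2) the distribution functions of `X` and of `X − S`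
have finitely many discontinuity points in `[0, M]`; (3) the distribution function of `X`
is strictly increasing on `[0, M]`; (4) `𝔼[(X − y)⁺ − (X − y − S)⁺] > 0` for `y ∈ [0, M)`. -/
def AssumpA (ℙ : Measure Ω) (X S : Ω → ℝ) (M : ℝ) : Prop :=
  (∀ᵐ ω ∂ℙ, 0 ≤ S ω) ∧
  (JumpSet ℙ X M).Finite ∧
  (JumpSet ℙ (fun ω => X ω - S ω) M).Finite ∧
  StrictMonoOn (distFn ℙ X) (Icc 0 M) ∧
  ∀ y ∈ Ico (0 : ℝ) M, 0 < ∫ ω, (max (X ω - y) 0 - max (X ω - y - S ω) 0) ∂ℙ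

/-- `g_a(y) = (1+η)·𝔼[(X − y)⁺ − (X − y − (S+a))⁺] − a`. -/
def gA (ℙ : Measure Ω) (η : ℝ) (X S : Ω → ℝ) (a y : ℝ) : ℝ :=
  (1 + η) * ∫ ω, (max (X ω - y) 0 - max (X ω - y - (S ω + a)) 0) ∂ℙ - a

/-- The threshold `u′(w − M)/𝔼[u′(w − X)] − 1` for the premium loading. -/
def thr (ℙ : Measure Ω) (X : Ω → ℝ) (u' : ℝ → ℝ) (w M : ℝ) : ℝ :=
  u' (w - M) / (∫ ω, u' (w - X ω) ∂ℙ) - 1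

/-- `dfun` is the deductible map `a ↦ d(a)`: for each `a ∈ [0, ā]`, `d(a)` is the
(unique) zero of `g_a` in `[0, M]`. -/
def DFun (ℙ : Measure Ω) (η : ℝ) (X S : Ω → ℝ) (M : ℝ) (dfun : ℝ → ℝ) : Prop :=
  ∀ a ∈ Icc 0 (abar ℙ η X S), dfun a ∈ Icc (0 : ℝ) M ∧ gA ℙ η X S a (dfun a) = 0

/-- `(astar, dstar)` is the optimal premium–deductible pair: `(0, M)` if
`η ≥ u′(w−M)/𝔼[u′(w−X)] − 1`; otherwise `astar ∈ (0, ā)` is the unique solution of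
`𝔼[u′(w − min(X, d(a)) − a)] = u′(w − d(a) − a)/(1+η)` and `dstar = d(astar)`. -/
def OptPair (ℙ : Measure Ω) (η : ℝ) (X S : Ω → ℝ) (u' : ℝ → ℝ) (w M : ℝ)
    (dfun : ℝ → ℝ) (astar dstar : ℝ) : Prop :=
  (thr ℙ X u' w M ≤ η → astar = 0 ∧ dstar = M) ∧
  (η < thr ℙ X u' w M →
    astar ∈ Ioo 0 (abar ℙ η X S) ∧
    (∫ ω, u' (w - min (X ω) (dfun astar) - astar) ∂ℙ)
      = u' (w - dfun astar - astar) / (1 + η) ∧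
    dstar = dfun astar)

/-- Strict monotonicity of the integral: an a.e. inequality that is strict on a set of nonzero
measure. -/
lemma integral_lt_of_ae_le_of_lt_on {μ : Measure Ω} {f g : Ω → ℝ} {s : Set Ω}
    (hf : Integrable f μ) (hg : Integrable g μ) (hle : ∀ᵐ ω ∂μ, f ω ≤ g ω)
    (hs : μ s ≠ 0) (hlt : ∀ ω ∈ s, f ω < g ω) : ∫ ω, f ω ∂μ < ∫ ω, g ω ∂μ := by
  rw [← sub_pos, ← integral_sub hg hf]
  refine (integral_pos_iff_support_of_nonneg_ae ?_ (hg.sub hf)).2 ?_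
  · filter_upwards [hle] with ω hω
    exact sub_nonneg.2 hω
  · refine (pos_iff_ne_zero.2 hs).trans_le (measure_mono fun ω hω => ?_)
    exact (sub_pos.2 (hlt ω hω)).ne'

/-- A real random variable with positive essential supremum is essentially bounded by it. -/
lemma ae_le_of_essSup_eq_pos {μ : Measure Ω} {X : Ω → ℝ} {M : ℝ}
    (hM : essSup X μ = M) (hM0 : 0 < M) : ∀ᵐ ω ∂μ, X ω ≤ M := by
  subst hM
  refine ae_le_essSup ?_
  by_contra hbdd
  have hempty : {a : ℝ | ∀ᵐ ω ∂μ, X ω ≤ a} = ∅ := by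
    refine eq_empty_of_forall_notMem fun a ha => hbdd ⟨a, ?_⟩
    simpa using ha
  rw [essSup, Filter.limsup_eq, hempty, Real.sInf_empty] at hM0
  exact hM0.false

/-- If the distribution function of `X` is strictly increasing on `[0, M]`, then `X` lies below
any `d ∈ (0, M]` with positive probability. -/
lemma measure_setOf_lt_ne_zero {μ : Measure Ω} {X : Ω → ℝ} {M d : ℝ}
    (hF : StrictMonoOn (distFn μ X) (Icc 0 M)) (hd0 : 0 < d) (hdM : d ≤ M) :
    μ {ω | X ω < d} ≠ 0 := by
  intro h0
  have hlt : distFn μ X 0 < distFn μ X (d / 2) :=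
    hF ⟨le_rfl, by linarith⟩ ⟨by linarith, by linarith⟩ (by linarith)
  have hzero : μ {ω | X ω ≤ d / 2} = 0 := by
    refine measure_mono_null (fun ω hω => ?_) h0
    have : X ω ≤ d / 2 := hω
    change X ω < d
    linarith
  have hnonneg : 0 ≤ distFn μ X 0 := ENNReal.toReal_nonneg
  have heq : distFn μ X (d / 2) = 0 := by simp [distFn, hzero]
  linarith

/-- Under decreasing absolute risk aversion, the marginal-utility ratio `u'(v + t) / u'(v)` is
nondecreasing in `v` for `t ≥ 0`. -/
lemma marginal_ratio_mono {u' u'' : ℝ → ℝ} (hu'' : ∀ x, HasDerivAt u' (u'' x) x)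
    (hpos : ∀ x, 0 < u' x) (hDARA : Antitone (fun x => -u'' x / u' x))
    {v₁ v₂ t : ℝ} (hv : v₁ ≤ v₂) (ht : 0 ≤ t) :
    u' (v₁ + t) / u' v₁ ≤ u' (v₂ + t) / u' v₂ := by
  have hderiv : ∀ x, HasDerivAt (fun x => Real.log (u' (x + t)) - Real.log (u' x))
      (u'' (x + t) / u' (x + t) - u'' x / u' x) x := fun x =>
    (((hu'' (x + t)).comp_add_const x t).log (hpos _).ne').sub ((hu'' x).log (hpos x).ne')
  have hmono : Monotone (fun x => Real.log (u' (x + t)) - Real.log (u' x)) := by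
    refine monotone_of_deriv_nonneg (fun x => (hderiv x).differentiableAt) fun x => ?_
    rw [(hderiv x).deriv]
    have h : -u'' (x + t) / u' (x + t) ≤ -u'' x / u' x := hDARA (by linarith)
    rw [neg_div, neg_div] at h
    linarith
  have h : Real.log (u' (v₁ + t)) - Real.log (u' v₁)
      ≤ Real.log (u' (v₂ + t)) - Real.log (u' v₂) := hmono hv
  rw [← Real.log_div (hpos _).ne' (hpos _).ne', ← Real.log_div (hpos _).ne' (hpos _).ne'] at h
  exact (Real.log_le_log_iff (div_pos (hpos _) (hpos _)) (div_pos (hpos _) (hpos _))).1 h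

/-- The layer `(X - y)⁺ - (X - y - (S + a))⁺` is integrable. -/
lemma integrable_layer {μ : Measure Ω} [IsFiniteMeasure μ] {X S : Ω → ℝ} {M a y : ℝ}
    (hXm : Measurable X) (hSm : Measurable S) (hXM : ∀ᵐ ω ∂μ, X ω ≤ M)
    (hS : ∀ᵐ ω ∂μ, 0 ≤ S ω) (ha : 0 ≤ a) :
    Integrable (fun ω => max (X ω - y) 0 - max (X ω - y - (S ω + a)) 0) μ := by
  refine Integrable.of_mem_Icc 0 (max (M - y) 0) (by fun_prop) ?_
  filter_upwards [hXM, hS] with ω h1 h2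
  constructor
  · rw [sub_nonneg]
    exact max_le_max_right 0 (by linarith)
  · have := max_le_max_right 0 (sub_le_sub_right h1 y)
    linarith [le_max_right (X ω - y - (S ω + a)) 0]

/-- If `(a₁, y₁)` and `(a₂, y₂)` both satisfy the premium equation, `a₂ < a₁`, and
`(1 + η) ℙ(X > y₁) < 1`, then the premium plus deductible is smaller at the larger premium. -/
lemma premium_add_deductible_le {μ : Measure Ω} [IsFiniteMeasure μ] {X S : Ω → ℝ}
    {M η a₁ a₂ y₁ y₂ : ℝ} (hη : 0 < η)
    (hXm : Measurable X) (hSm : Measurable S) (hXM : ∀ᵐ ω ∂μ, X ω ≤ M)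
    (hS : ∀ᵐ ω ∂μ, 0 ≤ S ω) (ha₂ : 0 ≤ a₂) (ha : a₂ < a₁)
    (htail : (1 + η) * μ.real {ω | y₁ < X ω} < 1)
    (h₁ : gA μ η X S a₁ y₁ = 0) (h₂ : gA μ η X S a₂ y₂ = 0) :
    a₁ + y₁ ≤ a₂ + y₂ := by
  by_contra! hlt
  have hmeas : MeasurableSet {ω | y₁ < X ω} := measurableSet_lt measurable_const hXm
  have hind : Integrable ({ω | y₁ < X ω}.indicator fun _ => a₁ - a₂) μ :=
    (integrable_const _).indicator hmeas
  have hle : ∫ ω, (max (X ω - y₁) 0 - max (X ω - y₁ - (S ω + a₁)) 0) ∂μ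
      ≤ ∫ ω, ((max (X ω - y₂) 0 - max (X ω - y₂ - (S ω + a₂)) 0)
        + {ω | y₁ < X ω}.indicator (fun _ => a₁ - a₂) ω) ∂μ := by
    refine integral_mono_ae (integrable_layer hXm hSm hXM hS (ha₂.trans ha.le))
      ((integrable_layer hXm hSm hXM hS ha₂).add hind) ?_
    filter_upwards [hS] with ω hω
    by_cases hx : y₁ < X ω
    · rw [indicator_of_mem (show ω ∈ {ω | y₁ < X ω} from hx)]
      grind
    · rw [indicator_of_notMem (show ω ∉ {ω | y₁ < X ω} from hx)]
      grind
  rw [integral_add (integrable_layer hXm hSm hXM hS ha₂) hind, integral_indicator_const _ hmeas,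
    smul_eq_mul] at hle
  unfold gA at h₁ h₂
  have hmul := mul_le_mul_of_nonneg_left hle (by linarith : 0 ≤ 1 + η)
  nlinarith [mul_lt_mul_of_pos_right htail (sub_pos.2 ha)]

/-- The normalized marginal utility of retained wealth is integrable. -/
lemma integrable_marginal_ratio {μ : Measure Ω} [IsFiniteMeasure μ] {X : Ω → ℝ} {u' : ℝ → ℝ}
    (hXm : Measurable X) (hcont : Continuous u') (hpos : ∀ x, 0 < u' x) (hanti : Antitone u')
    (w a d : ℝ) :
    Integrable (fun ω => u' (w - min (X ω) d - a) / u' (w - d - a)) μ := by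
  refine Integrable.of_mem_Icc 0 1 ?_ (Filter.Eventually.of_forall fun ω => ?_)
  · exact ((hcont.measurable.comp (by fun_prop)).div_const _).aemeasurable
  · refine ⟨(div_pos (hpos _) (hpos _)).le, (div_le_one (hpos _)).2 (hanti ?_)⟩
    linarith [min_le_right (X ω) d]

/-- The first-order condition in normalized form forces a positive deductible. -/
lemma deductible_pos_of_foc {μ : Measure Ω} [IsProbabilityMeasure μ] {X : Ω → ℝ} {u' : ℝ → ℝ}
    {η w a d : ℝ} (hη : 0 < η) (hX0 : ∀ ω, 0 ≤ X ω) (hpos : ∀ x, 0 < u' x) (hd : 0 ≤ d)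
    (hfoc : ∫ ω, u' (w - min (X ω) d - a) / u' (w - d - a) ∂μ = 1 / (1 + η)) : 0 < d := by
  refine hd.lt_of_ne fun h0 => ?_
  subst h0
  simp only [min_eq_right (hX0 _), div_self (hpos _).ne', integral_const, probReal_univ,
    one_smul] at hfoc
  rw [eq_div_iff (by linarith)] at hfoc
  linarith

/-- The first-order condition bounds the probability that the loss exceeds the deductible. -/
lemma tail_lt_of_foc {μ : Measure Ω} [IsProbabilityMeasure μ] {X : Ω → ℝ} {u' : ℝ → ℝ}
    {η w a d : ℝ} (hη : 0 < η) (hXm : Measurable X) (hcont : Continuous u')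
    (hpos : ∀ x, 0 < u' x) (hanti : Antitone u') (hlow : μ {ω | X ω < d} ≠ 0)
    (hfoc : ∫ ω, u' (w - min (X ω) d - a) / u' (w - d - a) ∂μ = 1 / (1 + η)) :
    (1 + η) * μ.real {ω | d < X ω} < 1 := by
  have hmeas : MeasurableSet {ω | d < X ω} := measurableSet_lt measurable_const hXm
  have hlt : ∫ ω, {ω | d < X ω}.indicator (fun _ => (1 : ℝ)) ω ∂μ
      < ∫ ω, u' (w - min (X ω) d - a) / u' (w - d - a) ∂μ := by
    refine integral_lt_of_ae_le_of_lt_on ((integrable_const _).indicator hmeas)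
      (integrable_marginal_ratio hXm hcont hpos hanti w a d)
      (Filter.Eventually.of_forall fun ω => ?_) hlow fun ω hω => ?_
    · by_cases hx : d < X ω
      · rw [indicator_of_mem (show ω ∈ {ω | d < X ω} from hx), min_eq_right hx.le,
          div_self (hpos _).ne']
      · rw [indicator_of_notMem (show ω ∉ {ω | d < X ω} from hx)]
        exact (div_pos (hpos _) (hpos _)).le
    · have hω : X ω < d := hω
      rw [indicator_of_notMem (show ω ∉ {ω | d < X ω} from hω.le.not_gt)]
      exact div_pos (hpos _) (hpos _)
  rw [integral_indicator_const _ hmeas, smul_eq_mul, mul_one, hfoc,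
    lt_div_iff₀ (by linarith)] at hlt
  linarith

/-- Under decreasing absolute risk aversion, the loading threshold is nonincreasing in wealth. -/
lemma thr_antitone {μ : Measure Ω} [IsProbabilityMeasure μ] {X : Ω → ℝ} {u' u'' : ℝ → ℝ} {M : ℝ}
    (hXm : Measurable X) (hXM : ∀ᵐ ω ∂μ, X ω ≤ M) (hu'' : ∀ x, HasDerivAt u' (u'' x) x)
    (hpos : ∀ x, 0 < u' x) (hanti : Antitone u') (hDARA : Antitone (fun x => -u'' x / u' x)) :
    Antitone (fun w => thr μ X u' w M) := by
  intro w₁ w₂ hw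
  have hcont : Continuous u' := continuous_iff_continuousAt.2 fun x => (hu'' x).continuousAt
  have hint : ∀ w, Integrable (fun ω => u' (w - X ω)) μ := fun w => by
    refine Integrable.of_mem_Icc 0 (u' (w - M)) ?_ ?_
    · exact (hcont.measurable.comp (by fun_prop)).aemeasurable
    · filter_upwards [hXM] with ω hω
      exact ⟨(hpos _).le, hanti (by linarith)⟩
  have hIpos : ∀ w, 0 < ∫ ω, u' (w - X ω) ∂μ := fun w => by
    have h := integral_lt_of_ae_le_of_lt_on (integrable_zero Ω ℝ μ) (hint w)
      (Filter.Eventually.of_forall fun ω => (hpos _).le) (s := univ) (by simp) fun ω _ => hpos _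
    simpa using h
  have hle : (∫ ω, u' (w₁ - X ω) ∂μ) / u' (w₁ - M) ≤ (∫ ω, u' (w₂ - X ω) ∂μ) / u' (w₂ - M) := by
    rw [← integral_div, ← integral_div]
    refine integral_mono_ae ((hint w₁).div_const _) ((hint w₂).div_const _) ?_
    filter_upwards [hXM] with ω hω
    have h := marginal_ratio_mono hu'' hpos hDARA (sub_le_sub_right hw M) (sub_nonneg.2 hω)
    simpa using h
  have h := inv_anti₀ (div_pos (hIpos w₁) (hpos _)) hle
  rw [inv_div, inv_div] at h
  exact sub_le_sub_right h 1

/-- If the normalized expected marginal utilities agree and the worst-case wealth `w - d - a` is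
higher in the second situation, then so is the deductible. -/
lemma deductible_le_of_foc {μ : Measure Ω} [IsFiniteMeasure μ] {X : Ω → ℝ} {u' u'' : ℝ → ℝ}
    {w₁ w₂ a₁ a₂ d₁ d₂ : ℝ} (hXm : Measurable X) (hu'' : ∀ x, HasDerivAt u' (u'' x) x)
    (hpos : ∀ x, 0 < u' x) (hanti : StrictAnti u') (hDARA : Antitone (fun x => -u'' x / u' x))
    (hlow : μ {ω | X ω < d₁} ≠ 0) (hv : w₁ - d₁ - a₁ ≤ w₂ - d₂ - a₂)
    (hfoc : ∫ ω, u' (w₁ - min (X ω) d₁ - a₁) / u' (w₁ - d₁ - a₁) ∂μ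
      = ∫ ω, u' (w₂ - min (X ω) d₂ - a₂) / u' (w₂ - d₂ - a₂) ∂μ) : d₁ ≤ d₂ := by
  by_contra! hlt
  have hcont : Continuous u' := continuous_iff_continuousAt.2 fun x => (hu'' x).continuousAt
  have hratio : ∀ ω, u' (w₁ - d₁ - a₁ + (d₂ - min (X ω) d₂)) / u' (w₁ - d₁ - a₁)
      ≤ u' (w₂ - min (X ω) d₂ - a₂) / u' (w₂ - d₂ - a₂) := fun ω => by
    have h := marginal_ratio_mono hu'' hpos hDARA hv (sub_nonneg.2 (min_le_right (X ω) d₂))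
    rwa [show w₂ - d₂ - a₂ + (d₂ - min (X ω) d₂) = w₂ - min (X ω) d₂ - a₂ by ring] at h
  refine hfoc.not_lt (integral_lt_of_ae_le_of_lt_on
    (integrable_marginal_ratio hXm hcont hpos hanti.antitone _ _ _)
    (integrable_marginal_ratio hXm hcont hpos hanti.antitone _ _ _)
    (Filter.Eventually.of_forall fun ω => (div_le_div_of_nonneg_right
      (hanti.antitone ?_) (hpos _).le).trans (hratio ω)) hlow
    fun ω hω => (div_lt_div_of_pos_right (hanti ?_) (hpos _)).trans_le (hratio ω))
  · grind
  · have hω : X ω < d₁ := hω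
    grind

/-- comparative statics in initial wealth under DARA. If `w₁ ≤ w₂`, then
`a₁* ≥ a₂*`, `d₁* ≤ d₂*`, and `a₁* + d₁* ≤ a₂* + d₂*`. -/
theorem stmt13
    (ℙ : Measure Ω) [IsProbabilityMeasure ℙ]
    (X S : Ω → ℝ) (hXm : Measurable X) (hSm : Measurable S)
    (hX0 : ∀ ω, 0 ≤ X ω) (M : ℝ) (hM : essSup X ℙ = M) (hM0 : 0 < M)
    (η : ℝ) (hη : 0 < η)
    (u u' u'' : ℝ → ℝ)
    (hu' : ∀ x, HasDerivAt u (u' x) x) (hu'' : ∀ x, HasDerivAt u' (u'' x) x)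
    (hu'pos : ∀ x, 0 < u' x) (hu''neg : ∀ x, u'' x < 0)
    (hDARA : Antitone (fun x => -u'' x / u' x))
    (hA : AssumpA ℙ X S M)
    (dfun : ℝ → ℝ) (hd : DFun ℙ η X S M dfun)
    (w₁ w₂ : ℝ) (hw : w₁ ≤ w₂)
    (a₁ d₁ a₂ d₂ : ℝ)
    (hp₁ : OptPair ℙ η X S u' w₁ M dfun a₁ d₁)
    (hp₂ : OptPair ℙ η X S u' w₂ M dfun a₂ d₂) :
    a₂ ≤ a₁ ∧ d₁ ≤ d₂ ∧ a₁ + d₁ ≤ a₂ + d₂ := by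
  obtain ⟨hS, -, -, hF, -⟩ := hA
  have hXM := ae_le_of_essSup_eq_pos hM hM0
  have hanti : StrictAnti u' :=
    strictAnti_of_deriv_neg fun x => by rw [(hu'' x).deriv]; exact hu''neg x
  have hcont : Continuous u' := continuous_iff_continuousAt.2 fun x => (hu'' x).continuousAt
  have hnormalize : ∀ w a d : ℝ,
      (∫ ω, u' (w - min (X ω) d - a) ∂ℙ) = u' (w - d - a) / (1 + η) →
      ∫ ω, u' (w - min (X ω) d - a) / u' (w - d - a) ∂ℙ = 1 / (1 + η) := fun w a d h => by
    rw [integral_div, h, div_right_comm, div_self (hu'pos _).ne']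
  have hlow : ∀ w a d : ℝ, d ∈ Icc 0 M →
      ∫ ω, u' (w - min (X ω) d - a) / u' (w - d - a) ∂ℙ = 1 / (1 + η) →
      ℙ {ω | X ω < d} ≠ 0 := fun w a d hdm h =>
    measure_setOf_lt_ne_zero hF (deductible_pos_of_foc hη hX0 hu'pos hdm.1 h) hdm.2
  have hthr : thr ℙ X u' w₂ M ≤ thr ℙ X u' w₁ M :=
    thr_antitone hXm hXM hu'' hu'pos hanti.antitone hDARA hw
  rcases le_or_gt (thr ℙ X u' w₁ M) η with h₁ | h₁
  · obtain ⟨rfl, rfl⟩ := hp₁.1 h₁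
    obtain ⟨rfl, rfl⟩ := hp₂.1 (hthr.trans h₁)
    exact ⟨le_rfl, le_rfl, le_rfl⟩
  obtain ⟨ha₁, hfoc₁, rfl⟩ := hp₁.2 h₁
  obtain ⟨hdm₁, hg₁⟩ := hd a₁ ⟨ha₁.1.le, ha₁.2.le⟩
  replace hfoc₁ := hnormalize _ _ _ hfoc₁
  have hlow₁ := hlow _ _ _ hdm₁ hfoc₁
  have htail₁ := tail_lt_of_foc hη hXm hcont hu'pos hanti.antitone hlow₁ hfoc₁
  rcases le_or_gt (thr ℙ X u' w₂ M) η with h₂ | h₂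
  · obtain ⟨rfl, rfl⟩ := hp₂.1 h₂
    have hgM : gA ℙ η X S 0 d₂ = 0 := by
      have hzero : ∫ ω, (max (X ω - d₂) 0 - max (X ω - d₂ - (S ω + 0)) 0) ∂ℙ = 0 := by
        refine integral_eq_zero_of_ae ?_
        filter_upwards [hXM, hS] with ω hω hω'
        rw [max_eq_right (by linarith), max_eq_right (by linarith), sub_zero, Pi.zero_apply]
      rw [gA, hzero]
      ring
    have hsum := premium_add_deductible_le hη hXm hSm hXM hS le_rfl ha₁.1 htail₁ hg₁ hgM
    exact ⟨ha₁.1.le, hdm₁.2, hsum⟩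
  obtain ⟨ha₂, hfoc₂, rfl⟩ := hp₂.2 h₂
  obtain ⟨hdm₂, hg₂⟩ := hd a₂ ⟨ha₂.1.le, ha₂.2.le⟩
  replace hfoc₂ := hnormalize _ _ _ hfoc₂
  rcases lt_trichotomy a₂ a₁ with ha | rfl | ha
  · have hsum := premium_add_deductible_le hη hXm hSm hXM hS ha₂.1.le ha htail₁ hg₁ hg₂
    exact ⟨ha.le, by linarith, hsum⟩
  · exact ⟨le_rfl, le_rfl, le_rfl⟩
  · exfalso
    have htail₂ := tail_lt_of_foc hη hXm hcont hu'pos hanti.antitone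
      (hlow _ _ _ hdm₂ hfoc₂) hfoc₂
    have hsum := premium_add_deductible_le hη hXm hSm hXM hS ha₁.1.le ha htail₂ hg₂ hg₁
    have hle := deductible_le_of_foc hXm hu'' hu'pos hanti hDARA hlow₁ (by linarith)
      (hfoc₁.trans hfoc₂.symm)
    linarith
end
end

section
/- Suppose Assumption A holds. Let 𝓧_Δ and 𝓩_Δ denote the (finite) sets of discontinuity points in [0, M] of the distribution functions of X and of X − S, respectively, and let B = {a ∈ (0, ā] : d(a) ∈ 𝓧_Δ or d(a) + a ∈ 𝓩_Δ}. Then: (i) the map a ↦ d(a) is continuous on [0, ā]; (ii) B is a finite set; and (iii) d is continuously differentiable on (0, ā] \ B with d′(a) = ((1+η)·ℙ(X > d(a)+S+a) − 1) / ((1+η)·ℙ(d(a) < X ≤ d(a)+S+a)). -/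
open MeasureTheory Set

noncomputable section

variable {Ω : Type*} [MeasurableSpace Ω]
/-- The exceptional set `B = {a ∈ (0, ā] : d(a) ∈ 𝓧_Δ or d(a) + a ∈ 𝓩_Δ}`. -/
def Bset (ℙ : Measure Ω) (η : ℝ) (X S : Ω → ℝ) (M : ℝ) (dfun : ℝ → ℝ) : Set ℝ :=
  {a ∈ Ioc (0 : ℝ) (abar ℙ η X S) |
    dfun a ∈ JumpSet ℙ X M ∨ dfun a + a ∈ JumpSet ℙ (fun ω => X ω - S ω) M}

/-- The derivative formula
`d′(a) = ((1+η)·ℙ(X > d(a)+S+a) − 1)/((1+η)·ℙ(d(a) < X ≤ d(a)+S+a))`. -/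
def Dform (ℙ : Measure Ω) (η : ℝ) (X S : Ω → ℝ) (dfun : ℝ → ℝ) (a : ℝ) : ℝ :=
  ((1 + η) * (ℙ {ω | dfun a + S ω + a < X ω}).toReal - 1) /
    ((1 + η) * (ℙ {ω | dfun a < X ω ∧ X ω ≤ dfun a + S ω + a}).toReal)

/-- The stop-loss transform `t ↦ 𝔼[(Y − t)⁺]`. -/
def stopLoss (ℙ : Measure Ω) (Y : Ω → ℝ) (t : ℝ) : ℝ := ∫ ω, max (Y ω - t) 0 ∂ℙ

lemma integrable_max_sub {ℙ : Measure Ω} [IsFiniteMeasure ℙ] {Y : Ω → ℝ} {M : ℝ}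
    (hY : Measurable Y) (hM : ∀ᵐ ω ∂ℙ, Y ω ≤ M) (t : ℝ) :
    Integrable (fun ω => max (Y ω - t) 0) ℙ := by
  refine Integrable.of_bound (by fun_prop) (max (M - t) 0) ?_
  filter_upwards [hM] with ω hω
  rw [Real.norm_of_nonneg (le_max_right _ _)]
  gcongr

lemma one_sub_distFn {ℙ : Measure Ω} [IsProbabilityMeasure ℙ] {Y : Ω → ℝ}
    (hY : Measurable Y) (t : ℝ) : 1 - distFn ℙ Y t = ℙ.real {ω | t < Y ω} := by
  have h := probReal_compl_eq_one_sub (μ := ℙ) (measurableSet_le hY (measurable_const (a := t)))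
  rw [show distFn ℙ Y t = ℙ.real {ω | Y ω ≤ t} from rfl, ← h]
  congr 1
  ext ω
  simp

lemma integral_indicator_Ioi {ℙ : Measure Ω} [IsProbabilityMeasure ℙ] {Y : Ω → ℝ}
    (hY : Measurable Y) (c t : ℝ) :
    ∫ ω, {ω | t < Y ω}.indicator (fun _ => c) ω ∂ℙ = c * (1 - distFn ℙ Y t) := by
  rw [integral_indicator_const _ (measurableSet_lt measurable_const hY), one_sub_distFn hY,
    smul_eq_mul, mul_comm]

lemma le_stopLoss_sub {ℙ : Measure Ω} [IsProbabilityMeasure ℙ] {Y : Ω → ℝ} {M : ℝ}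
    (hY : Measurable Y) (hM : ∀ᵐ ω ∂ℙ, Y ω ≤ M) {s t : ℝ} (hst : s ≤ t) :
    (t - s) * (1 - distFn ℙ Y t) ≤ stopLoss ℙ Y s - stopLoss ℙ Y t := by
  rw [stopLoss, stopLoss,
    ← integral_sub (integrable_max_sub hY hM s) (integrable_max_sub hY hM t),
    ← integral_indicator_Ioi hY]
  refine integral_mono ((integrable_const _).indicator (measurableSet_lt measurable_const hY))
    ((integrable_max_sub hY hM s).sub (integrable_max_sub hY hM t)) fun ω => ?_
  by_cases h : t < Y ω
  · simp only [indicator, mem_ofPred_eq, h, if_true]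
    rw [max_eq_left (by linarith), max_eq_left (by linarith)]
    linarith
  · simp only [indicator, mem_ofPred_eq, h, if_false]
    exact sub_nonneg.2 (by gcongr)

lemma stopLoss_sub_le {ℙ : Measure Ω} [IsProbabilityMeasure ℙ] {Y : Ω → ℝ} {M : ℝ}
    (hY : Measurable Y) (hM : ∀ᵐ ω ∂ℙ, Y ω ≤ M) {s t : ℝ} (hst : s ≤ t) :
    stopLoss ℙ Y s - stopLoss ℙ Y t ≤ (t - s) * (1 - distFn ℙ Y s) := by
  rw [stopLoss, stopLoss,
    ← integral_sub (integrable_max_sub hY hM s) (integrable_max_sub hY hM t),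
    ← integral_indicator_Ioi hY]
  refine integral_mono ((integrable_max_sub hY hM s).sub (integrable_max_sub hY hM t))
    ((integrable_const _).indicator (measurableSet_lt measurable_const hY)) fun ω => ?_
  by_cases h : s < Y ω
  · simp only [indicator, mem_ofPred_eq, h, if_true]
    rw [max_eq_left (by linarith)]
    linarith [le_max_left (Y ω - t) 0]
  · simp only [indicator, mem_ofPred_eq, h, if_false]
    rw [max_eq_right (by linarith), max_eq_right (by linarith)]
    simp

lemma distFn_nonneg (ℙ : Measure Ω) (Y : Ω → ℝ) (t : ℝ) : 0 ≤ distFn ℙ Y t :=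
  ENNReal.toReal_nonneg

lemma distFn_le_one (ℙ : Measure Ω) [IsProbabilityMeasure ℙ] (Y : Ω → ℝ) (t : ℝ) :
    distFn ℙ Y t ≤ 1 :=
  measureReal_le_one

lemma distFn_mono (ℙ : Measure Ω) [IsProbabilityMeasure ℙ] (Y : Ω → ℝ) :
    Monotone (distFn ℙ Y) := fun _ _ h =>
  measureReal_mono fun _ hω => le_trans hω h

lemma distFn_eq_one {ℙ : Measure Ω} [IsProbabilityMeasure ℙ] {Y : Ω → ℝ} {M t : ℝ}
    (hM : ∀ᵐ ω ∂ℙ, Y ω ≤ M) (ht : M ≤ t) : distFn ℙ Y t = 1 := by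
  have h : ℙ {ω | Y ω ≤ t} = ℙ univ :=
    measure_congr (Filter.eventuallyEq_univ.2 (hM.mono fun ω hω => hω.trans ht))
  simp [distFn, h]

lemma continuousAt_distFn {ℙ : Measure Ω} [IsProbabilityMeasure ℙ] {Y : Ω → ℝ} {M t : ℝ}
    (hM : ∀ᵐ ω ∂ℙ, Y ω ≤ M) (ht0 : 0 ≤ t) (ht : t ∉ JumpSet ℙ Y M) :
    ContinuousAt (distFn ℙ Y) t := by
  rcases le_or_gt t M with h | h
  · by_contra hc
    exact ht ⟨⟨ht0, h⟩, hc⟩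
  · refine (continuousAt_const (y := (1 : ℝ))).congr ?_
    filter_upwards [lt_mem_nhds h] with x hx
    exact (distFn_eq_one hM hx.le).symm

lemma continuous_stopLoss {ℙ : Measure Ω} [IsProbabilityMeasure ℙ] {Y : Ω → ℝ} {M : ℝ}
    (hY : Measurable Y) (hM : ∀ᵐ ω ∂ℙ, Y ω ≤ M) : Continuous (stopLoss ℙ Y) := by
  refine LipschitzWith.continuous (K := 1) (LipschitzWith.of_le_add fun s t => ?_)
  rw [Real.dist_eq]
  rcases le_total s t with h | h
  · have h1 := stopLoss_sub_le hY hM h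
    have h2 := distFn_nonneg ℙ Y s
    rw [abs_sub_comm, abs_of_nonneg (sub_nonneg.2 h)]
    nlinarith
  · have h1 := le_stopLoss_sub hY hM h
    have h2 := distFn_le_one ℙ Y s
    have h3 := mul_nonneg (sub_nonneg.2 h) (sub_nonneg.2 h2)
    linarith [abs_nonneg (s - t)]

lemma hasDerivAt_stopLoss {ℙ : Measure Ω} [IsProbabilityMeasure ℙ] {Y : Ω → ℝ} {M t : ℝ}
    (hY : Measurable Y) (hM : ∀ᵐ ω ∂ℙ, Y ω ≤ M) (hc : ContinuousAt (distFn ℙ Y) t) :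
    HasDerivAt (stopLoss ℙ Y) (distFn ℙ Y t - 1) t := by
  rw [hasDerivAt_iff_tendsto_slope, tendsto_iff_dist_tendsto_zero]
  have h0 : Filter.Tendsto (fun s => dist (distFn ℙ Y s) (distFn ℙ Y t)) (nhdsWithin t {t}ᶜ)
      (nhds 0) := (tendsto_iff_dist_tendsto_zero.1 hc).mono_left nhdsWithin_le_nhds
  refine squeeze_zero' (Filter.Eventually.of_forall fun _ => dist_nonneg) ?_ h0
  filter_upwards [self_mem_nhdsWithin] with s hs
  rw [Real.dist_eq, Real.dist_eq, slope_def_field]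
  rcases lt_or_gt_of_ne (show s ≠ t from hs) with h | h
  · have h1 := stopLoss_sub_le hY hM h.le
    have h2 := le_stopLoss_sub hY hM h.le
    have hpos : 0 < t - s := sub_pos.2 h
    have e : (stopLoss ℙ Y s - stopLoss ℙ Y t) / (s - t) =
        -((stopLoss ℙ Y s - stopLoss ℙ Y t) / (t - s)) := by
      rw [← neg_sub t s, div_neg]
    have h3 : (stopLoss ℙ Y s - stopLoss ℙ Y t) / (t - s) ≤ 1 - distFn ℙ Y s := by
      rw [div_le_iff₀ hpos]; linarith
    have h4 : 1 - distFn ℙ Y t ≤ (stopLoss ℙ Y s - stopLoss ℙ Y t) / (t - s) := by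
      rw [le_div_iff₀ hpos]; linarith
    rw [e, abs_of_nonpos (by linarith), abs_of_nonpos (by linarith)]
    linarith
  · have h1 := stopLoss_sub_le hY hM h.le
    have h2 := le_stopLoss_sub hY hM h.le
    have hpos : 0 < s - t := sub_pos.2 h
    have h3 : (stopLoss ℙ Y s - stopLoss ℙ Y t) / (s - t) ≤ distFn ℙ Y s - 1 := by
      rw [div_le_iff₀ hpos]; linarith
    have h4 : distFn ℙ Y t - 1 ≤ (stopLoss ℙ Y s - stopLoss ℙ Y t) / (s - t) := by
      rw [le_div_iff₀ hpos]; linarith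
    rw [abs_of_nonneg (by linarith), abs_of_nonneg (by linarith)]
    linarith

/-- The stop-loss transform is strictly convex where the distribution function is strictly
increasing. -/
lemma strictConvexOn_stopLoss {ℙ : Measure Ω} [IsProbabilityMeasure ℙ] {Y : Ω → ℝ} {M : ℝ}
    (hY : Measurable Y) (hM : ∀ᵐ ω ∂ℙ, Y ω ≤ M) {s : Set ℝ} (hs : Convex ℝ s)
    (hF : StrictMonoOn (distFn ℙ Y) s) : StrictConvexOn ℝ s (stopLoss ℙ Y) := by
  refine strictConvexOn_of_slope_strict_mono_adjacent hs fun {x y z} hx hz hxy hyz => ?_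
  have hy : y ∈ s := hs.ordConnected.out hx hz ⟨hxy.le, hyz.le⟩
  obtain ⟨m, hym, hmz⟩ := exists_between hyz
  have hm : m ∈ s := hs.ordConnected.out hx hz ⟨(hxy.trans hym).le, hmz.le⟩
  have h1 := le_stopLoss_sub hY hM hxy.le
  have h2 := stopLoss_sub_le hY hM hym.le
  have h3 := stopLoss_sub_le hY hM hmz.le
  have h4 := mul_pos (sub_pos.2 hmz) (sub_pos.2 (hF hy hm hym))
  calc _ ≤ distFn ℙ Y y - 1 := by
        rw [div_le_iff₀ (sub_pos.2 hxy)]; linarith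
    _ < _ := by
        rw [lt_div_iff₀ (sub_pos.2 hyz)]; linarith

/-- A strictly convex function meets an affine function at most twice. -/
lemma StrictConvexOn.finite_eq_affine {s : Set ℝ} {f : ℝ → ℝ} (hf : StrictConvexOn ℝ s f)
    (b c : ℝ) : {x ∈ s | f x = b * x + c}.Finite := by
  have key : ∀ x ∈ {x ∈ s | f x = b * x + c}, ∀ y ∈ {x ∈ s | f x = b * x + c},
      ∀ z ∈ {x ∈ s | f x = b * x + c}, x < y → y < z → False := by
    rintro x ⟨hx, ex⟩ y ⟨-, ey⟩ z ⟨hz, ez⟩ hxy hyz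
    have h := hf.slope_strict_mono_adjacent hx hz hxy hyz
    rw [ex, ey, ez, div_lt_div_iff₀ (sub_pos.2 hxy) (sub_pos.2 hyz)] at h
    linarith
  by_cases hsub : {x ∈ s | f x = b * x + c}.Subsingleton
  · exact hsub.finite
  · rw [not_subsingleton_iff] at hsub
    obtain ⟨x, hx, y, hy, hxy⟩ := hsub.exists_lt
    refine (Set.toFinite {x, y}).subset fun z hz => ?_
    rcases lt_trichotomy z x with h | h | h
    · exact (key z hz x hx y hy h hxy).elim
    · exact Or.inl h
    · rcases lt_trichotomy z y with h' | h' | h'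
      · exact (key x hx z hz y hy h h').elim
      · exact Or.inr h'
      · exact (key x hx y hy z hz hxy h').elim

lemma stopLoss_eq_zero {ℙ : Measure Ω} {Y : Ω → ℝ} {M : ℝ}
    (hM : ∀ᵐ ω ∂ℙ, Y ω ≤ M) {t : ℝ} (ht : M ≤ t) :
    stopLoss ℙ Y t = 0 := by
  refine integral_eq_zero_of_ae ?_
  filter_upwards [hM] with ω hω
  exact max_eq_right (by linarith)

lemma gA_zero_pos {ℙ : Measure Ω} {X S : Ω → ℝ} {M η : ℝ} (hη : 0 ≤ η)
    (hpos : ∀ y ∈ Ico (0 : ℝ) M, 0 < ∫ ω, (max (X ω - y) 0 - max (X ω - y - S ω) 0) ∂ℙ)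
    {y : ℝ} (hy : y ∈ Ico 0 M) : 0 < gA ℙ η X S 0 y := by
  have h := mul_pos (by linarith : 0 < 1 + η) (hpos y hy)
  simpa [gA] using h

section Deductible

variable {ℙ : Measure Ω} [IsProbabilityMeasure ℙ] {X S : Ω → ℝ} {M η : ℝ}

lemma gA_eq_stopLoss (hXm : Measurable X) (hSm : Measurable S) (hXM : ∀ᵐ ω ∂ℙ, X ω ≤ M)
    (hXS : ∀ᵐ ω ∂ℙ, X ω - S ω ≤ M) (a y : ℝ) :
    gA ℙ η X S a y =
      (1 + η) * (stopLoss ℙ X y - stopLoss ℙ (fun ω => X ω - S ω) (y + a)) - a := by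
  have hZm : Measurable fun ω => X ω - S ω := hXm.sub hSm
  rw [gA, stopLoss, stopLoss, ← integral_sub (integrable_max_sub hXm hXM y)
    (integrable_max_sub hZm hXS (y + a))]
  congr 3
  ext ω
  congr 2
  ring

lemma distFn_lt_distFn_sub (hS : ∀ᵐ ω ∂ℙ, 0 ≤ S ω) (hF : StrictMonoOn (distFn ℙ X) (Icc 0 M))
    {a y : ℝ} (ha : 0 < a) (hy : y ∈ Ico 0 M) :
    distFn ℙ X y < distFn ℙ (fun ω => X ω - S ω) (y + a) := by
  have hlt : y < min (y + a) M := lt_min (by linarith) hy.2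
  calc distFn ℙ X y < distFn ℙ X (min (y + a) M) :=
        hF ⟨hy.1, hy.2.le⟩ ⟨hy.1.trans hlt.le, min_le_right _ _⟩ hlt
    _ ≤ distFn ℙ X (y + a) := distFn_mono ℙ X (min_le_left _ _)
    _ ≤ distFn ℙ (fun ω => X ω - S ω) (y + a) := by
        refine ENNReal.toReal_mono (measure_ne_top _ _) (measure_mono_ae ?_)
        filter_upwards [hS] with ω hω h
        exact (sub_le_self _ hω).trans h

lemma measureReal_deductible_interval (hXm : Measurable X) (hS : ∀ᵐ ω ∂ℙ, 0 ≤ S ω)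
    {a : ℝ} (ha : 0 ≤ a) (y : ℝ) :
    (ℙ {ω | y < X ω ∧ X ω ≤ y + S ω + a}).toReal =
      distFn ℙ (fun ω => X ω - S ω) (y + a) - distFn ℙ X y := by
  have hae : ({ω | y < X ω ∧ X ω ≤ y + S ω + a} ∪ {ω | X ω ≤ y} : Set Ω) =ᵐ[ℙ]
      {ω | X ω - S ω ≤ y + a} := by
    rw [Filter.eventuallyEq_set]
    filter_upwards [hS] with ω hω
    refine ⟨?_, fun h => ?_⟩
    · rintro (h | h)
      · exact (show X ω - S ω ≤ y + a by linarith [h.2])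
      · exact (show X ω - S ω ≤ y + a by linarith [show X ω ≤ y from h])
    · rcases le_or_gt (X ω) y with h' | h'
      · exact Or.inr h'
      · exact Or.inl ⟨h', by linarith [show X ω - S ω ≤ y + a from h]⟩
  have hdisj : Disjoint {ω | y < X ω ∧ X ω ≤ y + S ω + a} {ω | X ω ≤ y} :=
    Set.disjoint_left.2 fun ω h h' => absurd h.1 (not_lt.2 h')
  have h := measureReal_union (μ := ℙ) hdisj (measurableSet_le hXm measurable_const)
  rw [measureReal_congr hae] at h
  exact eq_sub_of_add_eq h.symm

lemma Dform_eq (hXm : Measurable X) (hSm : Measurable S) (hS : ∀ᵐ ω ∂ℙ, 0 ≤ S ω)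
    (d : ℝ → ℝ) {a : ℝ} (ha : 0 ≤ a) :
    Dform ℙ η X S d a =
      ((1 + η) * (1 - distFn ℙ (fun ω => X ω - S ω) (d a + a)) - 1) /
        ((1 + η) * (distFn ℙ (fun ω => X ω - S ω) (d a + a) - distFn ℙ X (d a))) := by
  have hZm : Measurable fun ω => X ω - S ω := hXm.sub hSm
  rw [Dform, measureReal_deductible_interval hXm hS ha, one_sub_distFn hZm]
  have e : {ω | d a + S ω + a < X ω} = {ω | d a + a < X ω - S ω} := by
    ext ω
    exact ⟨fun h => by simp only [mem_ofPred_eq] at *; linarith,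
      fun h => by simp only [mem_ofPred_eq] at *; linarith⟩
  rw [e, Measure.real]

lemma gA_strictAntiOn (hXm : Measurable X) (hSm : Measurable S) (hXM : ∀ᵐ ω ∂ℙ, X ω ≤ M)
    (hXS : ∀ᵐ ω ∂ℙ, X ω - S ω ≤ M) (hS : ∀ᵐ ω ∂ℙ, 0 ≤ S ω) (hη : 0 ≤ η)
    (hF : StrictMonoOn (distFn ℙ X) (Icc 0 M)) {a : ℝ} (ha : 0 < a) :
    StrictAntiOn (gA ℙ η X S a) (Icc 0 M) := by
  intro y hy z hz hyz
  obtain ⟨m, hym, hm⟩ := exists_between (lt_min hyz (lt_add_of_pos_right y ha))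
  have hmz := hm.trans_le (min_le_left _ _)
  have hma := hm.trans_le (min_le_right _ _)
  have hmem : m ∈ Ico 0 M := ⟨hy.1.trans hym.le, hmz.trans_le hz.2⟩
  have hZm : Measurable fun ω => X ω - S ω := hXm.sub hSm
  have hintegrable (t : ℝ) :
      Integrable (fun ω => max (X ω - t) 0 - max (X ω - t - (S ω + a)) 0) ℙ := by
    refine (integrable_max_sub hXm hXM t).sub
      ((integrable_max_sub hZm hXS (t + a)).congr (ae_of_all _ fun ω => ?_))
    exact congrArg (max · 0) (by ring)
  have hanti : gA ℙ η X S a z ≤ gA ℙ η X S a m := by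
    unfold gA
    refine sub_le_sub_right (mul_le_mul_of_nonneg_left (integral_mono_ae (hintegrable z) (hintegrable m) ?_)
      (by linarith)) a
    filter_upwards [hS] with ω hω
    grind
  refine hanti.trans_lt ?_
  rw [gA_eq_stopLoss hXm hSm hXM hXS, gA_eq_stopLoss hXm hSm hXM hXS]
  have h1 := le_stopLoss_sub hXm hXM hym.le
  have h2 := stopLoss_sub_le hZm hXS (add_le_add_left hym.le a)
  have h3 := distFn_lt_distFn_sub hS hF (sub_pos.2 hma) hmem
  rw [add_sub_cancel] at h3
  have h4 := mul_pos (sub_pos.2 hym) (sub_pos.2 h3)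
  refine sub_lt_sub_right (mul_lt_mul_of_pos_left ?_ (by linarith)) a
  linarith

end Deductible

/-- A zero selection of a jointly continuous function with unique zeros in a compact set is
continuous. -/
lemma continuousOn_of_unique_zero {A K : Set ℝ} (hK : IsCompact K) {G : ℝ → ℝ → ℝ}
    (hG : Continuous (Function.uncurry G)) {d : ℝ → ℝ} (hd : ∀ a ∈ A, d a ∈ K ∧ G a (d a) = 0)
    (huniq : ∀ a ∈ A, ∀ y ∈ K, G a y = 0 → y = d a) : ContinuousOn d A := by
  intro a ha
  refine hK.tendsto_nhds_of_unique_mapClusterPt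
    (eventually_nhdsWithin_of_forall fun b hb => (hd b hb).1) fun y hy hcl => ?_
  refine huniq a ha y hy (by_contra fun hne => ?_)
  have hev : ∀ᶠ p in nhds (a, y), Function.uncurry G p ≠ 0 :=
    hG.continuousAt.eventually_ne hne
  obtain ⟨P, hP, Q, hQ, hPQ⟩ := Filter.eventually_prod_iff.1 (nhds_prod_eq (x := a) (y := y) ▸ hev)
  obtain ⟨b, hbQ, hbP, hbA⟩ := ((hcl.frequently hQ).and_eventually
    ((hP.filter_mono nhdsWithin_le_nhds).and self_mem_nhdsWithin)).exists
  exact hPQ hbP hbQ (hd b hbA).2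

/-- under Assumption A, the deductible map `a ↦ d(a)` is continuous on
`[0, ā]`, the exceptional set `B` is finite, and `d` is continuously differentiable on
`(0, ā] \ B` with derivative given by the stated formula. -/
theorem stmt15
    (ℙ : Measure Ω) [IsProbabilityMeasure ℙ]
    (X S : Ω → ℝ) (hXm : Measurable X) (hSm : Measurable S)
    (hX0 : ∀ ω, 0 ≤ X ω) (M : ℝ) (hM : essSup X ℙ = M) (hM0 : 0 < M)
    (η : ℝ) (hη : 0 ≤ η)
    (hA : AssumpA ℙ X S M)
    (dfun : ℝ → ℝ)
    (hdfun : ∀ a ∈ Icc 0 (abar ℙ η X S),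
      dfun a ∈ Icc (0 : ℝ) M ∧ gA ℙ η X S a (dfun a) = 0) :
    ContinuousOn dfun (Icc 0 (abar ℙ η X S)) ∧
    (Bset ℙ η X S M dfun).Finite ∧
    (∀ a ∈ Ioc (0 : ℝ) (abar ℙ η X S) \ Bset ℙ η X S M dfun,
      HasDerivWithinAt dfun (Dform ℙ η X S dfun a) (Icc 0 (abar ℙ η X S)) a) ∧
    ContinuousOn (Dform ℙ η X S dfun)
      (Ioc (0 : ℝ) (abar ℙ η X S) \ Bset ℙ η X S M dfun) := by
  obtain ⟨hS, hXfin, hZfin, hF, hpos⟩ := hA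
  have hXM : ∀ᵐ ω ∂ℙ, X ω ≤ M := by
    have hne : {c : ℝ | ∀ᵐ ω ∂ℙ, X ω ≤ c}.Nonempty := by
      by_contra hempty
      rw [not_nonempty_iff_eq_empty] at hempty
      have h : essSup X ℙ = sInf {c : ℝ | ∀ᵐ ω ∂ℙ, X ω ≤ c} :=
        Filter.limsup_eq
      rw [h, hempty, Real.sInf_empty] at hM
      exact hM0.ne hM
    obtain ⟨c, hc⟩ := hne
    rw [← hM]
    exact ae_le_essSup ⟨c, hc⟩
  have hXS : ∀ᵐ ω ∂ℙ, X ω - S ω ≤ M := by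
    filter_upwards [hXM, hS] with ω h1 h2
    linarith
  have hZm : Measurable fun ω => X ω - S ω := hXm.sub hSm
  have hη1 : 0 < 1 + η := by linarith
  have hgA := gA_eq_stopLoss (η := η) hXm hSm hXM hXS
  have hGcont : Continuous (Function.uncurry (gA ℙ η X S)) := by
    have h1 := continuous_stopLoss hXm hXM
    have h2 := continuous_stopLoss hZm hXS
    have e : Function.uncurry (gA ℙ η X S) = fun p : ℝ × ℝ => (1 + η) * (stopLoss ℙ X p.2 -
        stopLoss ℙ (fun ω => X ω - S ω) (p.2 + p.1)) - p.1 := funext fun p => hgA p.1 p.2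
    rw [e]
    fun_prop
  have huniq : ∀ a ∈ Icc 0 (abar ℙ η X S), ∀ y ∈ Icc 0 M, gA ℙ η X S a y = 0 → y = dfun a := by
    intro a ha y hy h0
    obtain ⟨hd, hd0⟩ := hdfun a ha
    rcases ha.1.eq_or_lt with rfl | hapos
    · have hzero : ∀ z ∈ Icc 0 M, gA ℙ η X S 0 z = 0 → z = M := fun z hz hz0 =>
        hz.2.eq_of_not_lt fun hlt => (gA_zero_pos hη hpos ⟨hz.1, hlt⟩).ne' hz0
      rw [hzero y hy h0, hzero _ hd hd0]
    · exact (gA_strictAntiOn hXm hSm hXM hXS hS hη hF hapos).injOn hy hd (h0.trans hd0.symm)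
  have hcont : ContinuousOn dfun (Icc 0 (abar ℙ η X S)) :=
    continuousOn_of_unique_zero isCompact_Icc hGcont hdfun huniq
  have hzero : ∀ a ∈ Icc 0 (abar ℙ η X S), (1 + η) * (stopLoss ℙ X (dfun a) -
      stopLoss ℙ (fun ω => X ω - S ω) (dfun a + a)) - a = 0 := fun a ha => by
    rw [← hgA, (hdfun a ha).2]
  have hdlt : ∀ a ∈ Ioc 0 (abar ℙ η X S), dfun a ∈ Ico 0 M := by
    intro a ha
    obtain ⟨hd, -⟩ := hdfun a ⟨ha.1.le, ha.2⟩
    refine ⟨hd.1, hd.2.lt_of_ne fun h => ?_⟩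
    have h0 := hzero a ⟨ha.1.le, ha.2⟩
    rw [h, stopLoss_eq_zero hXM le_rfl, stopLoss_eq_zero hXS (by linarith [ha.1])] at h0
    linarith [ha.1]
  have hFX : ∀ a ∈ Ioc (0 : ℝ) (abar ℙ η X S) \ Bset ℙ η X S M dfun,
      ContinuousAt (distFn ℙ X) (dfun a) := fun a ha =>
    continuousAt_distFn hXM (hdlt a ha.1).1 fun h => ha.2 ⟨ha.1, Or.inl h⟩
  have hFZ : ∀ a ∈ Ioc (0 : ℝ) (abar ℙ η X S) \ Bset ℙ η X S M dfun,
      ContinuousAt (distFn ℙ fun ω => X ω - S ω) (dfun a + a) := fun a ha =>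
    continuousAt_distFn hXS (add_nonneg (hdlt a ha.1).1 ha.1.1.le)
      fun h => ha.2 ⟨ha.1, Or.inr h⟩
  have hden : ∀ a ∈ Ioc (0 : ℝ) (abar ℙ η X S),
      (1 + η) * (distFn ℙ (fun ω => X ω - S ω) (dfun a + a) - distFn ℙ X (dfun a)) ≠ 0 :=
    fun a ha => (mul_pos hη1
      (sub_pos.2 (distFn_lt_distFn_sub hS hF ha.1 (hdlt a ha)))).ne'
  refine ⟨hcont, ?_, fun a ha => ?_, ?_⟩
  · have hBX : ∀ x ∈ JumpSet ℙ X M,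
        {a ∈ Ioc 0 (abar ℙ η X S) | dfun a = x}.Finite := by
      intro x _
      refine Set.Subsingleton.finite ?_
      have key : ∀ a ∈ Ioc 0 (abar ℙ η X S), ∀ b ∈ Ioc 0 (abar ℙ η X S),
          dfun a = x → dfun b = x → ¬ a < b := by
        intro a ha b hb hax hbx hab
        have h0 := gA_zero_pos hη hpos (hdlt a ha)
        have h1 := hzero a ⟨ha.1.le, ha.2⟩
        have h2 := hzero b ⟨hb.1.le, hb.2⟩
        rw [hgA] at h0
        rw [hax] at h0 h1
        rw [hbx] at h2
        have h3 := le_stopLoss_sub hZm hXS (s := x + 0) (t := x + a) (by linarith [ha.1])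
        have h4 := stopLoss_sub_le hZm hXS (s := x + a) (t := x + b) (by linarith)
        have h5 := mul_le_mul_of_nonneg_left h3 hη1.le
        have h6 := mul_le_mul_of_nonneg_left h4 hη1.le
        have h7 : a * ((1 + η) * (1 - distFn ℙ (fun ω => X ω - S ω) (x + a)) - 1) < 0 := by
          linarith
        have h8 : 0 ≤ (b - a) * ((1 + η) * (1 - distFn ℙ (fun ω => X ω - S ω) (x + a)) - 1) := by
          linarith
        exact absurd (nonneg_of_mul_nonneg_right h8 (sub_pos.2 hab))
          (not_le.2 (neg_of_mul_neg_right h7 ha.1.le))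
      rintro a ⟨ha, hax⟩ b ⟨hb, hbx⟩
      exact le_antisymm (not_lt.1 (key b hb a ha hbx hax)) (not_lt.1 (key a ha b hb hax hbx))
    have hBZ : ∀ z ∈ JumpSet ℙ (fun ω => X ω - S ω) M,
        {a ∈ Ioc 0 (abar ℙ η X S) | dfun a + a = z}.Finite := by
      intro z _
      have hfin := (strictConvexOn_stopLoss hXm hXM (convex_Icc 0 M) hF).finite_eq_affine
        (-1 / (1 + η)) (z / (1 + η) + stopLoss ℙ (fun ω => X ω - S ω) z)
      refine (hfin.image fun y => z - y).subset ?_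
      rintro a ⟨ha, haz⟩
      refine ⟨dfun a, ⟨(hdfun a ⟨ha.1.le, ha.2⟩).1, ?_⟩, by simp only; linarith⟩
      have h0 := hzero a ⟨ha.1.le, ha.2⟩
      rw [haz] at h0
      field_simp
      linarith
    refine ((hXfin.biUnion hBX).union (hZfin.biUnion hBZ)).subset ?_
    rintro a ⟨ha, h | h⟩
    · exact Or.inl (mem_biUnion h ⟨ha, rfl⟩)
    · exact Or.inr (mem_biUnion h ⟨ha, rfl⟩)
  · have hIcc : a ∈ Icc 0 (abar ℙ η X S) := ⟨ha.1.1.le, ha.1.2⟩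
    have hda := hcont a hIcc
    have hdX := hasDerivAt_stopLoss hXm hXM (hFX a ha)
    have hdZ := hasDerivAt_stopLoss hZm hXS (hFZ a ha)
    set H := stopLoss ℙ X
    set K := stopLoss ℙ fun ω => X ω - S ω
    have hh : Filter.Tendsto (fun b => dslope H (dfun a) (dfun b))
        (nhdsWithin a (Icc 0 (abar ℙ η X S))) (nhds (distFn ℙ X (dfun a) - 1)) := by
      have h := (continuousAt_dslope_same.2 hdX.differentiableAt).tendsto.comp hda
      rwa [dslope_same, hdX.deriv] at h
    have hk : Filter.Tendsto (fun b => dslope K (dfun a + a) (dfun b + b))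
        (nhdsWithin a (Icc 0 (abar ℙ η X S)))
        (nhds (distFn ℙ (fun ω => X ω - S ω) (dfun a + a) - 1)) := by
      have h := (continuousAt_dslope_same.2 hdZ.differentiableAt).tendsto.comp
        (hda.add continuousWithinAt_id).tendsto
      rwa [dslope_same, hdZ.deriv] at h
    have hD : (1 + η) * ((distFn ℙ X (dfun a) - 1) -
        (distFn ℙ (fun ω => X ω - S ω) (dfun a + a) - 1)) ≠ 0 := by
      have h := neg_ne_zero.2 (hden a ha.1)
      contrapose! h
      linarith
    have hden' := (hh.sub hk).const_mul (1 + η)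
    have hquot := ((hk.const_mul (1 + η)).const_add 1).div hden' hD
    have hform : Dform ℙ η X S dfun a =
        (1 + (1 + η) * (distFn ℙ (fun ω => X ω - S ω) (dfun a + a) - 1)) /
        ((1 + η) * ((distFn ℙ X (dfun a) - 1) -
          (distFn ℙ (fun ω => X ω - S ω) (dfun a + a) - 1))) := by
      rw [Dform_eq hXm hSm hS dfun ha.1.1.le, div_eq_div_iff (hden a ha.1) hD]
      ring
    rw [hasDerivWithinAt_iff_tendsto_slope, hform]
    refine (hquot.mono_left (nhdsWithin_mono _ sdiff_subset)).congr' ?_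
    filter_upwards [self_mem_nhdsWithin, (hden'.eventually_ne hD).filter_mono
      (nhdsWithin_mono _ sdiff_subset)] with b hb hne
    rw [slope_def_field, Pi.div_apply, div_eq_div_iff hne (sub_ne_zero.2 hb.2)]
    have h1 := sub_smul_dslope H (dfun a) (dfun b)
    have h2 := sub_smul_dslope K (dfun a + a) (dfun b + b)
    have h3 := hzero a hIcc
    have h4 := hzero b hb.1
    rw [smul_eq_mul] at h1 h2
    linear_combination h3 - h4 - (1 + η) * h1 + (1 + η) * h2
  · have hcongr : EqOn (Dform ℙ η X S dfun) (fun a =>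
        ((1 + η) * (1 - distFn ℙ (fun ω => X ω - S ω) (dfun a + a)) - 1) /
        ((1 + η) * (distFn ℙ (fun ω => X ω - S ω) (dfun a + a) - distFn ℙ X (dfun a))))
        (Ioc (0 : ℝ) (abar ℙ η X S) \ Bset ℙ η X S M dfun) :=
      fun a ha => Dform_eq hXm hSm hS dfun ha.1.1.le
    refine ContinuousOn.congr (fun a ha => ?_) hcongr
    have hda : ContinuousWithinAt dfun (Ioc (0 : ℝ) (abar ℙ η X S) \ Bset ℙ η X S M dfun) a :=
      (hcont a ⟨ha.1.1.le, ha.1.2⟩).mono fun b hb => ⟨hb.1.1.le, hb.1.2⟩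
    have h1 := (hFX a ha).comp_continuousWithinAt hda
    have h2 := ContinuousAt.comp_continuousWithinAt (f := fun b => dfun b + b) (hFZ a ha)
      (hda.add continuousWithinAt_id)
    exact ((continuousWithinAt_const.mul (continuousWithinAt_const.sub h2)).sub
      continuousWithinAt_const).div (continuousWithinAt_const.mul (h2.sub h1)) (hden a ha.1)
end
end

section
/- Let s > 0 be a real number and define g_N(a) = (1+η)𝔼[X − (X − (s+a))⁺] − a for a ∈ [0, π_f]. Then there exists a unique ā_N ∈ [0, π_f] with g_N(ā_N) = 0; moreover g_N(a) > 0 for every a ∈ [0, ā_N) and g_N(a) < 0 for every a ∈ (ā_N, π_f]. -/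
open MeasureTheory Set

noncomputable section

variable {Ω : Type*} [MeasurableSpace Ω]

/-- `g_N(a) = (1+η)·𝔼[X − (X − (s+a))⁺] − a`. -/
def gN (ℙ : Measure Ω) (η : ℝ) (X : Ω → ℝ) (s a : ℝ) : ℝ :=
  (1 + η) * ∫ ω, (X ω - max (X ω - (s + a)) 0) ∂ℙ - a

/-- The retained loss `x - (x - c)⁺` is `min x c`. -/
lemma sub_max_sub_zero_eq_min (x c : ℝ) : x - max (x - c) 0 = min x c := by
  grind

lemma gN_eq_integral_min (ℙ : Measure Ω) (η : ℝ) (X : Ω → ℝ) (s a : ℝ) :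
    gN ℙ η X s a = (1 + η) * ∫ ω, min (X ω) (s + a) ∂ℙ - a := by
  simp only [gN, sub_max_sub_zero_eq_min]

/-- A random variable with positive real essential supremum is essentially bounded above:
otherwise the essential supremum would take the default value `0`. -/
lemma exists_ae_le_of_essSup_pos {ℙ : Measure Ω} {X : Ω → ℝ} (h : 0 < essSup X ℙ) :
    ∃ C, ∀ᵐ ω ∂ℙ, X ω ≤ C := by
  by_contra hC
  have hempty : {a : ℝ | ∀ᵐ ω ∂ℙ, X ω ≤ a} = ∅ :=
    eq_empty_of_forall_notMem fun a ha => hC ⟨a, ha⟩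
  rw [essSup, Filter.limsup_eq, hempty, Real.sInf_empty] at h
  exact h.false

lemma not_ae_eq_zero_of_essSup_pos {ℙ : Measure Ω} [IsProbabilityMeasure ℙ] {X : Ω → ℝ}
    (h : 0 < essSup X ℙ) : ¬ X =ᵐ[ℙ] 0 := by
  intro h0
  rw [essSup_congr_ae h0, Pi.zero_def, essSup_const _ (IsProbabilityMeasure.ne_zero ℙ)] at h
  exact h.false

lemma concaveOn_gN {ℙ : Measure Ω} [IsProbabilityMeasure ℙ] {X : Ω → ℝ}
    (hX : Integrable X ℙ) {η : ℝ} (hη : 0 ≤ η) (s : ℝ) :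
    ConcaveOn ℝ univ (gN ℙ η X s) := by
  have hint (c : ℝ) : Integrable (fun ω => min (X ω) c) ℙ := hX.inf (integrable_const c)
  refine ⟨convex_univ, fun x _ y _ p q hp hq hpq => ?_⟩
  simp only [gN_eq_integral_min, smul_eq_mul]
  have hmono : p * ∫ ω, min (X ω) (s + x) ∂ℙ + q * ∫ ω, min (X ω) (s + y) ∂ℙ
      ≤ ∫ ω, min (X ω) (s + (p * x + q * y)) ∂ℙ := by
    rw [← integral_const_mul, ← integral_const_mul,
      ← integral_add ((hint _).const_mul p) ((hint _).const_mul q)]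
    refine integral_mono (((hint _).const_mul p).add ((hint _).const_mul q)) (hint _) fun ω => ?_
    refine le_min ?_ ?_
    · calc p * min (X ω) (s + x) + q * min (X ω) (s + y)
          ≤ p * X ω + q * X ω := by gcongr <;> exact min_le_left _ _
        _ = X ω := by rw [← add_mul, hpq, one_mul]
    · calc p * min (X ω) (s + x) + q * min (X ω) (s + y)
          ≤ p * (s + x) + q * (s + y) := by gcongr <;> exact min_le_right _ _
        _ = (p + q) * s + (p * x + q * y) := by ring
        _ = s + (p * x + q * y) := by rw [hpq, one_mul]
  nlinarith [mul_le_mul_of_nonneg_left hmono (by linarith : 0 ≤ 1 + η)]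

lemma gN_zero_pos {ℙ : Measure Ω} [IsProbabilityMeasure ℙ] {X : Ω → ℝ}
    (hX : Integrable X ℙ) (hX0 : ∀ ω, 0 ≤ X ω) (hne : ¬ X =ᵐ[ℙ] 0)
    {η : ℝ} (hη : 0 ≤ η) {s : ℝ} (hs : 0 < s) : 0 < gN ℙ η X s 0 := by
  rw [gN_eq_integral_min, add_zero, sub_zero]
  have h0 : 0 ≤ fun ω => min (X ω) s := fun ω => le_min (hX0 ω) hs.le
  refine mul_pos (by linarith) ((integral_nonneg h0).lt_of_ne' fun h => hne ?_)
  rw [integral_eq_zero_iff_of_nonneg h0 (hX.inf (integrable_const s))] at h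
  filter_upwards [h] with ω hω
  simp only [Pi.zero_apply] at hω ⊢
  grind

lemma gN_piFull_nonpos {ℙ : Measure Ω} [IsProbabilityMeasure ℙ] {X : Ω → ℝ}
    (hX : Integrable X ℙ) {η : ℝ} (hη : 0 ≤ η) (s : ℝ) :
    gN ℙ η X s (piFull ℙ η X) ≤ 0 := by
  rw [gN_eq_integral_min, sub_nonpos]
  refine mul_le_mul_of_nonneg_left ?_ (by linarith)
  exact integral_mono (hX.inf (integrable_const _)) hX fun ω => min_le_left _ _

/-- A concave function that is positive at `0` is positive on `[0, b)` for every point `b`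
at which it is nonnegative. -/
lemma ConcaveOn.pos_of_mem_Ico {f : ℝ → ℝ} (hf : ConcaveOn ℝ univ f) (h0 : 0 < f 0)
    {b : ℝ} (hb : 0 ≤ f b) {a : ℝ} (ha : a ∈ Ico 0 b) : 0 < f a := by
  have hbpos : 0 < b := ha.1.trans_lt ha.2
  have hlt : 0 < 1 - a / b := sub_pos.2 ((div_lt_one hbpos).2 ha.2)
  have hab : 0 ≤ a / b := div_nonneg ha.1 hbpos.le
  have h := hf.2 (mem_univ 0) (mem_univ b) hlt.le hab (by ring)
  simp only [smul_eq_mul, mul_zero, zero_add, div_mul_cancel₀ a hbpos.ne'] at h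
  nlinarith [mul_pos hlt h0, mul_nonneg hab hb]

/-- for `s > 0` there is a unique `ā_N ∈ [0, π_f]` with `g_N(ā_N) = 0`;
moreover `g_N > 0` on `[0, ā_N)` and `g_N < 0` on `(ā_N, π_f]`. -/
theorem stmt16
    (ℙ : Measure Ω) [IsProbabilityMeasure ℙ]
    (X : Ω → ℝ) (hXm : Measurable X) (hX0 : ∀ ω, 0 ≤ X ω)
    (M : ℝ) (hM : essSup X ℙ = M) (hM0 : 0 < M)
    (η : ℝ) (hη : 0 ≤ η) (s : ℝ) (hs : 0 < s) :
    ∃ aN ∈ Icc (0 : ℝ) (piFull ℙ η X),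
      gN ℙ η X s aN = 0 ∧
      (∀ a ∈ Icc (0 : ℝ) (piFull ℙ η X), gN ℙ η X s a = 0 → a = aN) ∧
      (∀ a ∈ Ico (0 : ℝ) aN, 0 < gN ℙ η X s a) ∧
      (∀ a ∈ Ioc aN (piFull ℙ η X), gN ℙ η X s a < 0) := by
  have hpos : 0 < essSup X ℙ := hM ▸ hM0
  obtain ⟨C, hC⟩ := exists_ae_le_of_essSup_pos hpos
  have hX : Integrable X ℙ := by
    refine Integrable.of_bound hXm.aestronglyMeasurable C ?_
    filter_upwards [hC] with ω hω
    rwa [Real.norm_of_nonneg (hX0 ω)]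
  have hconc := concaveOn_gN hX hη s
  have h0 := gN_zero_pos hX hX0 (not_ae_eq_zero_of_essSup_pos hpos) hη hs
  have hpi : 0 ≤ piFull ℙ η X := mul_nonneg (by linarith) (integral_nonneg hX0)
  have hcont : ContinuousOn (gN ℙ η X s) (Icc 0 (piFull ℙ η X)) :=
    (hconc.continuousOn isOpen_univ).mono (subset_univ _)
  obtain ⟨b, hb, hgb⟩ := intermediate_value_Icc' hpi hcont ⟨gN_piFull_nonpos hX hη s, h0.le⟩
  have hleft : ∀ a ∈ Ico (0 : ℝ) b, 0 < gN ℙ η X s a := fun a ha =>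
    hconc.pos_of_mem_Ico h0 hgb.ge ha
  have hright : ∀ a ∈ Ioc b (piFull ℙ η X), gN ℙ η X s a < 0 := fun a ha => by
    by_contra! hga
    exact (hconc.pos_of_mem_Ico h0 hga ⟨hb.1, ha.1⟩).ne' hgb
  refine ⟨b, hb, hgb, fun a ha hga => ?_, hleft, hright⟩
  rcases lt_trichotomy a b with h | h | h
  · exact absurd hga (hleft a ⟨ha.1, h⟩).ne'
  · exact h
  · exact absurd hga (hright a ⟨h, ha.2⟩).ne
end
end

section
/- Suppose N = 2, τ = 1, s₂ > 0, the distribution function of X is strictly increasing on [0, M] with finitely many discontinuity points, and fix a premium level a ∈ [0, ā₂] with a + s₁ ≤ 0, where ā₂ is the unique zero on [0, π_f] of a ↦ (1+η)𝔼[X − (X − (s₂+a))⁺] − a. For 0 ≤ l₁ ≤ l₂ ≤ M, let I(x; l₁, l₂) = (x − l₁)⁺ − (x − l₁ − (a+s₁)⁺)⁺ + (x − l₂ − (a+s₁)⁺)⁺ − (x − l₂ − (a+s₂))⁺. Then: (i) the equation (1+η)𝔼[(X − l)⁺ − (X − l − (a+s₂))⁺] = a has a unique solution l̃ ∈ [0,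 M]; and (ii) every pair (l₁, l₂) with 0 ≤ l₁ ≤ l₂ ≤ M and (1+η)𝔼[I(X; l₁, l₂)] = a has l₂ = l̃, and the contract I(·; l̃, l̃)(x) = (x − l̃)⁺ − (x − l̃ − (a+s₂))⁺ maximizes 𝔼[u(W_S(I(·; l₁, l₂)))] over all such pairs. -/
open MeasureTheory Set

noncomputable section

variable {Ω : Type*} [MeasurableSpace Ω]

/-- Expected-value premium of a loss-dependent indemnity `I = I(x)`. -/
def piS (ℙ : Measure Ω) (η : ℝ) (X : Ω → ℝ) (I : ℝ → ℝ) : ℝ :=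
  (1 + η) * ∫ ω, I (X ω) ∂ℙ

/-- Buyer's terminal wealth `W_S(I) = w − X + 𝕀_S(X; I) − π(I)` where
`𝕀_S(X; I) = I(X)·1_{I(X) ≤ (S+π(I))⁺} + τ·(S+π(I))⁺·1_{I(X) > (S+π(I))⁺}`. -/
def wealthS (ℙ : Measure Ω) (η τ w : ℝ) (X S : Ω → ℝ) (I : ℝ → ℝ) (ω : Ω) : ℝ :=
  w - X ω +
    (if I (X ω) ≤ max (S ω + piS ℙ η X I) 0 then I (X ω)
     else τ * max (S ω + piS ℙ η X I) 0) - piS ℙ η X I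

/-- Buyer's expected utility `𝔼[u(W_S(I))]`. -/
def EUS (ℙ : Measure Ω) (η τ w : ℝ) (X S : Ω → ℝ) (u : ℝ → ℝ) (I : ℝ → ℝ) : ℝ :=
  ∫ ω, u (wealthS ℙ η τ w X S I ω) ∂ℙ

/-- The admissible set `𝓐_IC`: measurable, `I(0) = 0`, and
`0 ≤ I(x) − I(x′) ≤ x − x′` for all `0 ≤ x′ ≤ x ≤ M`. -/
def AIC (M : ℝ) (I : ℝ → ℝ) : Prop :=
  Measurable I ∧ I 0 = 0 ∧
    ∀ x' x : ℝ, 0 ≤ x' → x' ≤ x → x ≤ M → 0 ≤ I x - I x' ∧ I x - I x' ≤ x - x'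

/-- The two-layer parametric contract
`I(x; l₁, l₂) = (x−l₁)⁺ − (x−l₁−(a+s₁)⁺)⁺ + (x−l₂−(a+s₁)⁺)⁺ − (x−l₂−(a+s₂))⁺`. -/
def con (a s₁ s₂ l₁ l₂ : ℝ) (x : ℝ) : ℝ :=
  max (x - l₁) 0 - max (x - l₁ - max (a + s₁) 0) 0 +
    max (x - l₂ - max (a + s₁) 0) 0 - max (x - l₂ - (a + s₂)) 0

/-- The layer of width `c` above the deductible `l`. -/
def layer (c l x : ℝ) : ℝ := max (x - l) 0 - max (x - l - c) 0

lemma layer_nonneg {c : ℝ} (hc : 0 ≤ c) (l x : ℝ) : 0 ≤ layer c l x := by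
  unfold layer
  exact sub_nonneg.2 (max_le_max_right 0 (by linarith))

lemma layer_le {c : ℝ} (hc : 0 ≤ c) (l x : ℝ) : layer c l x ≤ c := by
  unfold layer
  rcases max_cases (x - l) 0 with h | h <;> rcases max_cases (x - l - c) 0 with h' | h' <;>
    linarith

lemma layer_anti {c : ℝ} (hc : 0 ≤ c) {l l' : ℝ} (hl : l ≤ l') (x : ℝ) :
    layer c l' x ≤ layer c l x := by
  unfold layer
  rcases max_cases (x - l) 0 with h | h <;> rcases max_cases (x - l - c) 0 with h' | h' <;>
    rcases max_cases (x - l') 0 with k | k <;>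
    rcases max_cases (x - l' - c) 0 with k' | k' <;> linarith

lemma layer_of_le {c l x : ℝ} (hc : 0 ≤ c) (hx : x ≤ l) : layer c l x = 0 := by
  unfold layer
  rw [max_eq_right (by linarith), max_eq_right (by linarith), sub_zero]

lemma layer_pos {c l x : ℝ} (hc : 0 < c) (hx : l < x) : 0 < layer c l x := by
  unfold layer
  rw [max_eq_left (by linarith)]
  exact sub_pos.2 (max_lt (by linarith) (by linarith))

lemma integrable_layer_s18 (ℙ : Measure Ω) [IsFiniteMeasure ℙ] {X : Ω → ℝ} (hX : Measurable X)
    {c : ℝ} (hc : 0 ≤ c) (l : ℝ) : Integrable (fun ω => layer c l (X ω)) ℙ := by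
  refine Integrable.of_bound (C := c) ?_ (ae_of_all _ fun ω => ?_)
  · unfold layer
    exact (by fun_prop : Measurable _).aestronglyMeasurable
  · rw [Real.norm_eq_abs, abs_of_nonneg (layer_nonneg hc _ _)]
    exact layer_le hc _ _

lemma continuous_integral_layer (ℙ : Measure Ω) [IsFiniteMeasure ℙ] {X : Ω → ℝ}
    (hX : Measurable X) {c : ℝ} (hc : 0 ≤ c) :
    Continuous fun l => ∫ ω, layer c l (X ω) ∂ℙ := by
  refine continuous_of_dominated (bound := fun _ => c)
    (fun l => (integrable_layer_s18 ℙ hX hc l).aestronglyMeasurable)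
    (fun l => ae_of_all _ fun ω => ?_) (integrable_const c) (ae_of_all _ fun ω => ?_)
  · rw [Real.norm_eq_abs, abs_of_nonneg (layer_nonneg hc _ _)]
    exact layer_le hc _ _
  · unfold layer
    fun_prop

/-- The expected layer payment strictly decreases in the deductible on `[0, M]` when the
distribution function strictly increases there. -/
lemma strictAntiOn_integral_layer (ℙ : Measure Ω) [IsFiniteMeasure ℙ] {X : Ω → ℝ}
    (hX : Measurable X) {c M : ℝ} (hc : 0 < c) (hsm : StrictMonoOn (distFn ℙ X) (Icc 0 M)) :
    StrictAntiOn (fun l => ∫ ω, layer c l (X ω) ∂ℙ) (Icc 0 M) := by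
  intro l hl l' hl' hlt
  refine lt_of_le_of_ne (integral_mono (integrable_layer_s18 ℙ hX hc.le l')
    (integrable_layer_s18 ℙ hX hc.le l) fun ω => layer_anti hc.le hlt.le _) fun heq => ?_
  have hae := (integral_eq_iff_of_ae_le (integrable_layer_s18 ℙ hX hc.le l')
    (integrable_layer_s18 ℙ hX hc.le l)
    (ae_of_all _ fun ω => layer_anti hc.le hlt.le _)).1 heq
  have hle : ℙ {ω | X ω ≤ l'} ≤ ℙ {ω | X ω ≤ l} := by
    refine measure_mono_ae ?_
    filter_upwards [hae] with ω hω (hωl' : X ω ≤ l')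
    by_contra hn
    have hpos := layer_pos hc (not_le.1 hn)
    rw [← hω, layer_of_le hc.le hωl'] at hpos
    exact hpos.false
  exact (hsm hl hl' hlt).not_ge (ENNReal.toReal_mono (measure_ne_top _ _) hle)

/-- A real random variable with positive essential supremum is bounded by it. -/
lemma ae_le_of_essSup_pos (ℙ : Measure Ω) {X : Ω → ℝ} (hpos : 0 < essSup X ℙ) :
    ∀ᵐ ω ∂ℙ, X ω ≤ essSup X ℙ := by
  refine ae_le_essSup ?_
  by_contra hb
  have hempty : {b : ℝ | ∀ᵐ ω ∂ℙ, X ω ≤ b} = ∅ :=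
    eq_empty_of_forall_notMem fun b hbm => hb ⟨b, Filter.eventually_map.2 hbm⟩
  rw [essSup, Filter.limsup_eq, hempty, Real.sInf_empty] at hpos
  exact hpos.false

lemma min_add_concave {x s a b : ℝ} (ha : 0 ≤ a) (hab : a ≤ b) :
    (b - a) * min x s + a * min x (s + b) ≤ b * min x (s + a) := by
  have hx : (b - a) * min x s + a * min x (s + b) ≤ b * x := by
    nlinarith [mul_le_mul_of_nonneg_left (min_le_left x s) (sub_nonneg.2 hab),
      mul_le_mul_of_nonneg_left (min_le_left x (s + b)) ha]
  have hs : (b - a) * min x s + a * min x (s + b) ≤ b * (s + a) := by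
    nlinarith [mul_le_mul_of_nonneg_left (min_le_right x s) (sub_nonneg.2 hab),
      mul_le_mul_of_nonneg_left (min_le_right x (s + b)) ha]
  rcases min_cases x (s + a) with h | h <;> rw [h.1] <;> assumption

lemma sub_max_sub_eq_min (x t : ℝ) : x - max (x - t) 0 = min x t := by
  rcases le_total x t with h | h
  · rw [min_eq_left h, max_eq_right (by linarith), sub_zero]
  · rw [min_eq_right h, max_eq_left (by linarith)]; ring

/-- By concavity, `gN` is nonnegative to the left of a zero. -/
lemma gN_nonneg_of_le_zero (ℙ : Measure Ω) [IsFiniteMeasure ℙ] {X : Ω → ℝ}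
    (hX : Integrable X ℙ) (hX0 : ∀ ω, 0 ≤ X ω) {η s a b : ℝ} (hη : 0 ≤ η) (hs : 0 ≤ s)
    (ha : 0 ≤ a) (hab : a ≤ b) (hb : gN ℙ η X s b = 0) : 0 ≤ gN ℙ η X s a := by
  rcases ha.eq_or_lt with rfl | hapos
  · simp only [gN, sub_zero]
    refine mul_nonneg (by linarith) (integral_nonneg fun ω => ?_)
    simp only [sub_max_sub_eq_min, add_zero]
    exact le_min (hX0 ω) hs
  · simp only [gN, sub_max_sub_eq_min] at hb ⊢
    have hint (t : ℝ) : Integrable (fun ω => min (X ω) t) ℙ := hX.inf (integrable_const t)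
    have hconc : (b - a) * ∫ ω, min (X ω) s ∂ℙ + a * ∫ ω, min (X ω) (s + b) ∂ℙ
        ≤ b * ∫ ω, min (X ω) (s + a) ∂ℙ := by
      rw [← integral_const_mul, ← integral_const_mul, ← integral_const_mul,
        ← integral_add ((hint _).const_mul _) ((hint _).const_mul _)]
      exact integral_mono (((hint _).const_mul _).add ((hint _).const_mul _))
        ((hint _).const_mul _) fun ω => min_add_concave ha hab
    have hzero : 0 ≤ (b - a) * ∫ ω, min (X ω) s ∂ℙ :=
      mul_nonneg (by linarith) (integral_nonneg fun ω => le_min (hX0 ω) hs)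
    have hmul : (1 + η) * (a * ∫ ω, min (X ω) (s + b) ∂ℙ)
        ≤ (1 + η) * (b * ∫ ω, min (X ω) (s + a) ∂ℙ) :=
      mul_le_mul_of_nonneg_left (by linarith) (by linarith)
    refine nonneg_of_mul_nonneg_right (a := b) ?_ (by linarith)
    linear_combination hmul - a * hb

lemma con_eq_layer {a s₁ : ℝ} (h : a + s₁ ≤ 0) (s₂ l₁ l₂ : ℝ) :
    con a s₁ s₂ l₁ l₂ = layer (a + s₂) l₂ := by
  funext x
  simp only [con, layer, max_eq_right h, sub_zero, sub_self, zero_add]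

/-- Case 1 of Proposition 4.1: `N = 2`, `τ = 1`, `s₂ > 0`, `a + s₁ ≤ 0`.
The single-deductible equation has a unique solution `l̃ ∈ [0, M]`; every feasible
`(l₁, l₂)` has `l₂ = l̃`; and the contract with `l₁ = l₂ = l̃`, which equals
`(x − l̃)⁺ − (x − l̃ − (a+s₂))⁺`, maximizes expected utility among feasible pairs. -/
theorem stmt18
    (ℙ : Measure Ω) [IsProbabilityMeasure ℙ]
    (X S : Ω → ℝ) (hXm : Measurable X) (hSm : Measurable S)
    (hX0 : ∀ ω, 0 ≤ X ω) (M : ℝ) (hM : essSup X ℙ = M) (hM0 : 0 < M)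
    (η : ℝ) (hη : 0 ≤ η) (τ : ℝ) (hτ1 : τ = 1) (w : ℝ)
    (u u' u'' : ℝ → ℝ)
    (hu' : ∀ x, HasDerivAt u (u' x) x) (hu'' : ∀ x, HasDerivAt u' (u'' x) x)
    (hu'pos : ∀ x, 0 < u' x) (hu''neg : ∀ x, u'' x < 0)
    (s₁ s₂ : ℝ) (h12 : s₁ < s₂) (hs2 : 0 < s₂)
    (hp₁ : 0 < ℙ {ω | S ω = s₁}) (hp₂ : 0 < ℙ {ω | S ω = s₂})
    (hrange : ∀ᵐ ω ∂ℙ, S ω = s₁ ∨ S ω = s₂)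
    (hindep : ProbabilityTheory.IndepFun X S ℙ)
    (hsm : StrictMonoOn (distFn ℙ X) (Icc 0 M))
    (hjump : {x ∈ Icc (0 : ℝ) M | ¬ ContinuousAt (distFn ℙ X) x}.Finite)
    (abar2 : ℝ) (habar2 : abar2 ∈ Icc (0 : ℝ) (piFull ℙ η X) ∧ gN ℙ η X s₂ abar2 = 0)
    (a : ℝ) (ha : a ∈ Icc 0 abar2) (has1 : a + s₁ ≤ 0) :
    ∃ lt ∈ Icc (0 : ℝ) M,
      ((1 + η) * ∫ ω, (max (X ω - lt) 0 - max (X ω - lt - (a + s₂)) 0) ∂ℙ = a) ∧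
      (∀ l' ∈ Icc (0 : ℝ) M,
        (1 + η) * ∫ ω, (max (X ω - l') 0 - max (X ω - l' - (a + s₂)) 0) ∂ℙ = a →
        l' = lt) ∧
      (∀ x : ℝ, con a s₁ s₂ lt lt x = max (x - lt) 0 - max (x - lt - (a + s₂)) 0) ∧
      (∀ l₁ l₂ : ℝ, 0 ≤ l₁ → l₁ ≤ l₂ → l₂ ≤ M →
        (1 + η) * ∫ ω, con a s₁ s₂ l₁ l₂ (X ω) ∂ℙ = a →
        l₂ = lt ∧
          EUS ℙ η τ w X S u (con a s₁ s₂ l₁ l₂)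
            ≤ EUS ℙ η τ w X S u (con a s₁ s₂ lt lt)) := by
  have hc : 0 < a + s₂ := by linarith [ha.1]
  have hη1 : 0 < 1 + η := by linarith
  have hXM : ∀ᵐ ω ∂ℙ, X ω ≤ M := hM ▸ ae_le_of_essSup_pos ℙ (hM ▸ hM0)
  have hXint : Integrable X ℙ := by
    refine Integrable.of_bound (C := M) hXm.aestronglyMeasurable ?_
    filter_upwards [hXM] with ω hω
    rwa [Real.norm_eq_abs, abs_of_nonneg (hX0 ω)]
  have hanti := strictAntiOn_integral_layer ℙ hXm hc hsm
  have hzero : a ≤ (1 + η) * ∫ ω, layer (a + s₂) 0 (X ω) ∂ℙ := by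
    have hg := gN_nonneg_of_le_zero ℙ hXint hX0 hη hs2.le ha.1 ha.2 habar2.2
    have heq (ω : Ω) : layer (a + s₂) 0 (X ω) = X ω - max (X ω - (s₂ + a)) 0 := by
      rw [layer, sub_zero, max_eq_left (hX0 ω), add_comm]
    simp only [heq]
    exact sub_nonneg.1 hg
  have htop : (1 + η) * ∫ ω, layer (a + s₂) M (X ω) ∂ℙ ≤ a := by
    rw [integral_eq_zero_of_ae (hXM.mono fun ω hω => layer_of_le hc.le hω), mul_zero]
    exact ha.1
  obtain ⟨lt, hlt, heq⟩ := intermediate_value_Icc' hM0.le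
    ((continuous_integral_layer ℙ hXm hc.le).const_mul (1 + η)).continuousOn ⟨htop, hzero⟩
  have huniq : ∀ l ∈ Icc (0 : ℝ) M,
      (1 + η) * ∫ ω, layer (a + s₂) l (X ω) ∂ℙ = a → l = lt := fun l hl h =>
    hanti.injOn hl hlt (mul_left_cancel₀ hη1.ne' (h.trans heq.symm))
  refine ⟨lt, hlt, heq, huniq, fun x => congrFun (con_eq_layer has1 s₂ lt lt) x, ?_⟩
  intro l₁ l₂ h1 h2 h3 h
  rw [con_eq_layer has1] at h ⊢
  obtain rfl := huniq l₂ ⟨h1.trans h2, h3⟩ h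
  exact ⟨rfl, (congrArg _ (con_eq_layer has1 s₂ l₂ l₂)).ge⟩
end
end

section
/- Let u : ℝ → ℝ be twice differentiable with u′ > 0 and u″ < 0, and suppose the Arrow–Pratt coefficient of absolute risk aversion −u″/u′ is a nonincreasing function (DARA). Let X be a nonnegative bounded random variable on a probability space, and fix a ∈ ℝ and d ≥ 0. Then the function w ↦ 𝔼[u′(w − min(X, d) − a)] / u′(w − d − a) is nondecreasing in w; equivalently, w ↦ −𝔼[u′(w − min(X, d) − a)]/u′(w − d − a) + 1/(1+η) is nonincreasing in w for any η ≥ 0. -/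
open MeasureTheory Set

noncomputable section

variable {Ω : Type*} [MeasurableSpace Ω]

/-- If `f > 0` has a nonincreasing coefficient `-f' / f`, then `w ↦ f (w + s) / f w` is
nondecreasing for every shift `s ≥ 0`. -/
lemma monotone_shift_div_of_antitone_neg_deriv_div {f f' : ℝ → ℝ}
    (hf : ∀ x, HasDerivAt f (f' x) x) (hpos : ∀ x, 0 < f x)
    (hanti : Antitone (fun x => -f' x / f x)) {s : ℝ} (hs : 0 ≤ s) :
    Monotone (fun w => f (w + s) / f w) := by
  have hderiv : ∀ w, HasDerivAt (fun w => f (w + s) / f w)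
      ((f' (w + s) * f w - f (w + s) * f' w) / f w ^ 2) w := fun w =>
    ((hf (w + s)).comp_add_const w s).div (hf w) (hpos w).ne'
  refine monotone_of_deriv_nonneg (fun w => (hderiv w).differentiableAt) fun w => ?_
  rw [(hderiv w).deriv]
  have h : -f' (w + s) / f (w + s) ≤ -f' w / f w := hanti (by linarith : w ≤ w + s)
  rw [div_le_div_iff₀ (hpos _) (hpos _)] at h
  exact div_nonneg (by linarith) (sq_nonneg _)

/-- An antitone nonnegative function of a measurable function bounded below is integrable
with respect to a finite measure. -/
lemma integrable_antitone_comp {μ : Measure Ω} [IsFiniteMeasure μ] {f : ℝ → ℝ}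
    (hf : Antitone f) (hnonneg : ∀ x, 0 ≤ f x) {Y : Ω → ℝ} (hY : Measurable Y) {c : ℝ}
    (hc : ∀ ω, c ≤ Y ω) : Integrable (fun ω => f (Y ω)) μ := by
  refine Integrable.of_bound (hf.measurable.comp hY).aestronglyMeasurable (f c)
    (Filter.Eventually.of_forall fun ω => ?_)
  rw [Real.norm_of_nonneg (hnonneg _)]
  exact hf (hc ω)

/-- if `u` is twice differentiable with `u′ > 0`, `u″ < 0` and satisfies
DARA (the Arrow–Pratt coefficient `−u″/u′` is nonincreasing), and `X` is a nonnegative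
bounded random variable, then for any `a ∈ ℝ` and `d ≥ 0` the map
`w ↦ 𝔼[u′(w − min(X, d) − a)] / u′(w − d − a)` is nondecreasing; equivalently, for every
`η ≥ 0`, `w ↦ −𝔼[u′(w − min(X, d) − a)]/u′(w − d − a) + 1/(1+η)` is nonincreasing. -/
theorem stmt19
    (ℙ : Measure Ω) [IsProbabilityMeasure ℙ]
    (u u' u'' : ℝ → ℝ)
    (hu' : ∀ x, HasDerivAt u (u' x) x) (hu'' : ∀ x, HasDerivAt u' (u'' x) x)
    (hu'pos : ∀ x, 0 < u' x) (hu''neg : ∀ x, u'' x < 0)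
    (hDARA : Antitone (fun x => -u'' x / u' x))
    (X : Ω → ℝ) (hXm : Measurable X) (hX0 : ∀ ω, 0 ≤ X ω)
    (C : ℝ) (hXC : ∀ ω, X ω ≤ C)
    (a d : ℝ) (hd : 0 ≤ d) :
    Monotone (fun w : ℝ => (∫ ω, u' (w - min (X ω) d - a) ∂ℙ) / u' (w - d - a)) ∧
    ∀ η : ℝ, 0 ≤ η →
      Antitone (fun w : ℝ =>
        -(∫ ω, u' (w - min (X ω) d - a) ∂ℙ) / u' (w - d - a) + 1 / (1 + η)) := by
  have hanti : Antitone u' := antitone_of_hasDerivAt_nonpos hu'' fun x => (hu''neg x).le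
  have hint : ∀ w, Integrable (fun ω => u' (w - min (X ω) d - a)) ℙ := fun w =>
    integrable_antitone_comp hanti (fun x => (hu'pos x).le) (by fun_prop)
      (c := w - d - a) fun ω => by linarith [min_le_right (X ω) d]
  have hmono : Monotone
      (fun w : ℝ => (∫ ω, u' (w - min (X ω) d - a) ∂ℙ) / u' (w - d - a)) := by
    intro v w hvw
    simp only [← integral_div]
    refine integral_mono ((hint v).div_const _) ((hint w).div_const _) fun ω => ?_
    have h := monotone_shift_div_of_antitone_neg_deriv_div hu'' hu'pos hDARA
      (sub_nonneg.2 (min_le_right (X ω) d)) (by linarith : v - d - a ≤ w - d - a)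
    have hshift : ∀ x : ℝ, x - d - a + (d - min (X ω) d) = x - min (X ω) d - a :=
      fun x => by ring
    simpa only [hshift] using h
  refine ⟨hmono, fun η _ v w hvw => ?_⟩
  have h := hmono hvw
  simp only [neg_div] at h ⊢
  linarith
end
end
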